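/- arXiv:1809.06774 — 2 statements merged into one kernel-verified Lean document; each statement's English description precedes it below -/
import Mathlib

section
/- Let T be a class-sized prae-dilator and let T↾ℕ denote its restriction to natural numbers. For each linear order X, the map η^T_X : D^{T↾ℕ}_X → T_X defined by η^T_X(⟨a,σ⟩) := T_{ι_a ∘ en_a}(σ), where en_a : {0,…,|a|−1} → a is the increasing enumeration and ι_a : a ↪ X the inclusion, is an order isomorphism; the family η^T is natural, i.e. T_f ∘ η^T_X = η^T_Y ∘ D^{T↾ℕ}_f for every order embedding f : X → Y; and supp^T_X ∘ η^T_X = supp^{D^{T↾ℕ}}_X. -/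
/-- A class-sized prae-dilator: a functor on all (countable-or-not) linear orders together
with natural support functions. Orders on the values are given by the field `inst`. -/
structure ClassPraeDilator where
  A : (X : Type) → [LinearOrder X] → Type
  inst : ∀ (X : Type) [LinearOrder X], LinearOrder (A X)
  map : ∀ {X Y : Type} [LinearOrder X] [LinearOrder Y], (X ↪o Y) → A X → A Y
  map_strictMono : ∀ {X Y : Type} [LinearOrder X] [LinearOrder Y] (f : X ↪o Y) (σ τ : A X),
      (inst X).lt σ τ → (inst Y).lt (map f σ) (map f τ)
  map_id : ∀ (X : Type) [LinearOrder X] (σ : A X),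
      map (OrderIso.refl X).toOrderEmbedding σ = σ
  map_comp : ∀ {X Y Z : Type} [LinearOrder X] [LinearOrder Y] [LinearOrder Z]
      (f : X ↪o Y) (g : Y ↪o Z) (σ : A X), map (f.trans g) σ = map g (map f σ)
  supp : ∀ (X : Type) [LinearOrder X], A X → Finset X
  supp_natural : ∀ {X Y : Type} [LinearOrder X] [LinearOrder Y] (f : X ↪o Y) (σ : A X),
      supp Y (map f σ) = (supp X σ).map f.toEmbedding
  supp_spec : ∀ (X : Type) [LinearOrder X] (σ : A X),
      ∃ τ : A {x // x ∈ supp X σ}, map (OrderEmbedding.subtype (· ∈ supp X σ)) τ = σ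

/-- The strictly increasing map `Fin a.card ↪o Fin d.card` induced by an inclusion `a ⊆ d`. -/
def inclEmb {X : Type} [LinearOrder X] {a d : Finset X} (h : a ⊆ d) :
    Fin a.card ↪o Fin d.card :=
  OrderEmbedding.ofStrictMono
    (fun i => (d.orderIsoOfFin rfl).symm ⟨a.orderEmbOfFin rfl i, h (a.orderEmbOfFin_mem rfl i)⟩)
    (fun i j hij => by
      apply (d.orderIsoOfFin rfl).symm.strictMono
      exact Subtype.mk_lt_mk.mpr ((a.orderEmbOfFin rfl).strictMono hij))

/-- The order `D^{T↾ℕ}_X` for the restriction `T↾ℕ` of a class-sized prae-dilator `T`: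
pairs `⟨a,σ⟩` with `a` a finite subset of `X`, `σ ∈ T_{Fin |a|}` and full support. -/
structure DApp (C : ClassPraeDilator) (X : Type) [LinearOrder X] where
  a : Finset X
  σ : C.A (Fin a.card)
  hsupp : C.supp (Fin a.card) σ = Finset.univ

/-- The order relation on `D^{T↾ℕ}_X`. -/
def DLt (C : ClassPraeDilator) (X : Type) [LinearOrder X] (x y : DApp C X) : Prop :=
  (C.inst (Fin (x.a ∪ y.a).card)).lt
    (C.map (inclEmb (Finset.subset_union_left : x.a ⊆ x.a ∪ y.a)) x.σ)
    (C.map (inclEmb (Finset.subset_union_right : y.a ⊆ x.a ∪ y.a)) y.σ)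

/-- Transport along an equality of indices. -/
def castA (C : ClassPraeDilator) {n m : ℕ} (h : n = m) (σ : C.A (Fin n)) : C.A (Fin m) :=
  h ▸ σ

theorem supp_castA (C : ClassPraeDilator) {n m : ℕ} (h : n = m) (σ : C.A (Fin n)) :
    C.supp (Fin m) (castA C h σ) = Finset.univ ↔ C.supp (Fin n) σ = Finset.univ := by
  subst h; rfl

/-- The action `D^{T↾ℕ}_f(⟨a,σ⟩) = ⟨f[a],σ⟩` of `D^{T↾ℕ}` on an order embedding. -/
def DMap (C : ClassPraeDilator) {X Y : Type} [LinearOrder X] [LinearOrder Y] (f : X ↪o Y)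
    (x : DApp C X) : DApp C Y where
  a := x.a.map f.toEmbedding
  σ := castA C (Finset.card_map f.toEmbedding).symm x.σ
  hsupp := (supp_castA C _ _).mpr x.hsupp

/-- The comparison map `η^T_X : D^{T↾ℕ}_X → T_X`, `⟨a,σ⟩ ↦ T_{ι_a ∘ en_a}(σ)`. -/
def etaC (C : ClassPraeDilator) (X : Type) [LinearOrder X] (x : DApp C X) : C.A X :=
  C.map (x.a.orderEmbOfFin rfl) x.σ

namespace ClassPraeDilator

theorem map_lt_map_iff (C : ClassPraeDilator) {X Y : Type} [LinearOrder X] [LinearOrder Y]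
    (f : X ↪o Y) (σ τ : C.A X) :
    (C.inst Y).lt (C.map f σ) (C.map f τ) ↔ (C.inst X).lt σ τ := by
  let _ := C.inst X
  let _ := C.inst Y
  have h : StrictMono (C.map f) := fun σ τ => C.map_strictMono f σ τ
  exact h.lt_iff_lt

theorem map_injective (C : ClassPraeDilator) {X Y : Type} [LinearOrder X] [LinearOrder Y]
    (f : X ↪o Y) : Function.Injective (C.map f) := by
  let _ := C.inst X
  let _ := C.inst Y
  have h : StrictMono (C.map f) := fun σ τ => C.map_strictMono f σ τ
  exact h.injective

theorem map_castA (C : ClassPraeDilator) {Y : Type} [LinearOrder Y] {n m : ℕ} (h : n = m)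
    (g : Fin m ↪o Y) (σ : C.A (Fin n)) :
    C.map g (castA C h σ) = C.map ((Fin.castOrderIso h).toOrderEmbedding.trans g) σ := by
  subst h
  rfl

end ClassPraeDilator

theorem inclEmb_trans_orderEmbOfFin {X : Type} [LinearOrder X] {a d : Finset X} (h : a ⊆ d) :
    (inclEmb h).trans (d.orderEmbOfFin rfl) = a.orderEmbOfFin rfl := by
  ext i
  change ((d.orderIsoOfFin rfl ((d.orderIsoOfFin rfl).symm _) : d) : X) = _
  rw [OrderIso.apply_symm_apply]

theorem orderEmbOfFin_map {X Y : Type} [LinearOrder X] [LinearOrder Y] (a : Finset X)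
    (f : X ↪o Y) :
    (Fin.castOrderIso (Finset.card_map f.toEmbedding).symm).toOrderEmbedding.trans
      ((a.map f.toEmbedding).orderEmbOfFin rfl) = (a.orderEmbOfFin rfl).trans f := by
  have h : (a.orderEmbOfFin rfl).trans f =
      (a.map f.toEmbedding).orderEmbOfFin (Finset.card_map f.toEmbedding) :=
    Finset.orderEmbOfFin_unique' _ fun i =>
      Finset.mem_map_of_mem f.toEmbedding (a.orderEmbOfFin_mem rfl i)
  rw [h]
  ext i
  exact (Finset.orderEmbOfFin_eq_orderEmbOfFin_iff (h := rfl)).mpr rfl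

theorem map_orderEmbOfFin_univ {X : Type} [LinearOrder X] (a : Finset X) :
    Finset.univ.map (a.orderEmbOfFin rfl).toEmbedding = a := by
  ext x
  simp

theorem supp_etaC (C : ClassPraeDilator) {X : Type} [LinearOrder X] (x : DApp C X) :
    C.supp X (etaC C X x) = x.a := by
  rw [etaC, C.supp_natural, x.hsupp, map_orderEmbOfFin_univ]

theorem etaC_injective (C : ClassPraeDilator) (X : Type) [LinearOrder X] :
    Function.Injective (etaC C X) := by
  intro x y h
  have ha : x.a = y.a := by rw [← supp_etaC, h, supp_etaC]
  obtain ⟨a, σ, _⟩ := x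
  obtain ⟨b, τ, _⟩ := y
  obtain rfl : a = b := ha
  obtain rfl : σ = τ := C.map_injective _ h
  rfl

theorem etaC_surjective (C : ClassPraeDilator) (X : Type) [LinearOrder X] :
    Function.Surjective (etaC C X) := by
  intro τ
  obtain ⟨τ', hτ'⟩ := C.supp_spec X τ
  let e := (C.supp X τ).orderIsoOfFin rfl
  have h : C.map ((C.supp X τ).orderEmbOfFin rfl) (C.map e.symm.toOrderEmbedding τ') = τ := by
    rw [← C.map_comp]
    convert hτ'
    ext i
    exact congrArg Subtype.val (e.apply_symm_apply i)
  refine ⟨⟨C.supp X τ, C.map e.symm.toOrderEmbedding τ', ?_⟩, h⟩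
  apply Finset.map_injective ((C.supp X τ).orderEmbOfFin rfl).toEmbedding
  rw [← C.supp_natural, h, map_orderEmbOfFin_univ]

theorem dLt_iff_etaC_lt (C : ClassPraeDilator) {X : Type} [LinearOrder X] (x y : DApp C X) :
    DLt C X x y ↔ (C.inst X).lt (etaC C X x) (etaC C X y) := by
  rw [DLt, ← C.map_lt_map_iff ((x.a ∪ y.a).orderEmbOfFin rfl), ← C.map_comp, ← C.map_comp,
    inclEmb_trans_orderEmbOfFin, inclEmb_trans_orderEmbOfFin]
  rfl

theorem map_etaC (C : ClassPraeDilator) {X Y : Type} [LinearOrder X] [LinearOrder Y]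
    (f : X ↪o Y) (x : DApp C X) : C.map f (etaC C X x) = etaC C Y (DMap C f x) := by
  change C.map f (C.map _ _) = C.map ((x.a.map f.toEmbedding).orderEmbOfFin rfl) (castA C _ x.σ)
  rw [C.map_castA, orderEmbOfFin_map, C.map_comp]

/-- For a class-sized prae-dilator `T` and each linear order `X`, the map
`η^T_X : D^{T↾ℕ}_X → T_X`, `⟨a,σ⟩ ↦ T_{ι_a ∘ en_a}(σ)` is an order isomorphism, the family
`η^T` is natural, and it commutes with supports: `supp^T_X ∘ η^T_X = supp^{D^{T↾ℕ}}_X`. -/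
theorem etaC_natural_iso (C : ClassPraeDilator) (X : Type) [LinearOrder X] :
    Function.Bijective (etaC C X) ∧
    (∀ x y : DApp C X, DLt C X x y ↔ (C.inst X).lt (etaC C X x) (etaC C X y)) ∧
    (∀ (Y : Type) [LinearOrder Y] (f : X ↪o Y) (x : DApp C X),
      C.map f (etaC C X x) = etaC C Y (DMap C f x)) ∧
    (∀ x : DApp C X, C.supp X (etaC C X x) = x.a) := by
  exact ⟨⟨etaC_injective C X, etaC_surjective C X⟩, dLt_iff_etaC_lt C,
    fun _ _ f x => map_etaC C f x, supp_etaC C⟩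
end

section
/- If T is a class-sized prae-dilator such that T_X is well-founded for every well-order X, then its restriction T↾ℕ to natural numbers is a coded dilator: D^{T↾ℕ}_X is well-founded for every well-order X. -/
theorem map_inclEmb_eq_etaC (C : ClassPraeDilator) {X : Type} [LinearOrder X] (x : DApp C X)
    {d : Finset X} (h : x.a ⊆ d) :
    C.map (d.orderEmbOfFin rfl) (C.map (inclEmb h) x.σ) = etaC C X x := by
  rw [← C.map_comp, inclEmb_trans_orderEmbOfFin, etaC]

theorem etaC_lt_etaC (C : ClassPraeDilator) {X : Type} [LinearOrder X] {x y : DApp C X}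
    (h : DLt C X x y) : (C.inst X).lt (etaC C X x) (etaC C X y) := by
  have := C.map_strictMono ((x.a ∪ y.a).orderEmbOfFin rfl) _ _ h
  rwa [map_inclEmb_eq_etaC, map_inclEmb_eq_etaC] at this

/-- If `T` is a class-sized prae-dilator such that `T_X` is well-founded for
every well-order `X`, then its restriction `T↾ℕ` is a coded dilator: `D^{T↾ℕ}_X` is
well-founded for every well-order `X`. -/
theorem restriction_is_dilator (C : ClassPraeDilator)
    (hT : ∀ (X : Type) [LinearOrder X],
      WellFounded ((· < ·) : X → X → Prop) → WellFounded (C.inst X).lt) :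
    ∀ (X : Type) [LinearOrder X],
      WellFounded ((· < ·) : X → X → Prop) → WellFounded (DLt C X) := by
  intro X _ hX
  exact Subrelation.wf (fun h => etaC_lt_etaC C h) (InvImage.wf (etaC C X) (hT X hX))
end
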